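/- (Passive minimax lower bound, k = 1, small noise.) Fix c ∈ (0, 1/4]. There exist constants κ₀ > 0 and κ₁ > 0, depending only on c, such that for every integer n ≥ 1, every σ with 0 < σ ≤ κ₀/n, and every measurable estimator t̂ : ([−1,1] × {0,1})^n → ℝ, one has sup_{t ∈ [−1/2, 1/2]} E_{μ_{F_t}^{⊗n}} |t̂ − t| ≥ κ₁/n, where the expectation is over n i.i.d. samples (W_i, Y_i) from μ_{F_t}. -/

import Mathlib

open MeasureTheory Real
open scoped ENNReal

/-- Uniform-noise convolution: `(g ⋆ U_σ)(w) = (1/(2σ)) ∫_{w-σ}^{w+σ} g(x) dx`. -/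
noncomputable def unifConv (σ : ℝ) (g : ℝ → ℝ) (w : ℝ) : ℝ :=
  (1 / (2 * σ)) * ∫ x in (w - σ)..(w + σ), g x

/-- Step regression function with threshold `t` and jump size `c`. -/
noncomputable def stepFn (c t : ℝ) (x : ℝ) : ℝ :=
  if x < t then 1 / 2 - c else 1 / 2 + c

/-- The Bernoulli measure with parameter `p` on `Bool`. -/
noncomputable def bern (p : ℝ) : Measure Bool :=
  ENNReal.ofReal p • Measure.dirac true + ENNReal.ofReal (1 - p) • Measure.dirac false

/-- The law `μ_F` of a passive sample `(W, Y)`: `W` is uniform on `[-1,1]` and,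
conditionally on `W = w`, `Y` is `Bernoulli(F(w))`. -/
noncomputable def sampleLaw (F : ℝ → ℝ) : Measure (ℝ × Bool) :=
  ((2 : ℝ≥0∞)⁻¹ • (volume.restrict (Set.Icc (-1 : ℝ) 1))).bind
    (fun w => (bern (F w)).map (Prod.mk w))

theorem stepFn_mem_Icc {c : ℝ} (hc : c ∈ Set.Ioc (0 : ℝ) (1 / 4)) (t x : ℝ) :
    stepFn c t x ∈ Set.Icc (0 : ℝ) 1 := by
  obtain ⟨h0, h1⟩ := hc
  unfold stepFn
  split_ifs <;> constructor <;> linarith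

theorem measurable_stepFn (c t : ℝ) : Measurable (stepFn c t) :=
  Measurable.ite measurableSet_Iio measurable_const measurable_const

/-- Convolving with uniform noise preserves the bounds `0 ≤ g ≤ 1`. -/
theorem unifConv_mem_Icc {σ : ℝ} (hσ : 0 < σ) {g : ℝ → ℝ} (hg : ∀ x, g x ∈ Set.Icc (0 : ℝ) 1)
    (w : ℝ) : unifConv σ g w ∈ Set.Icc (0 : ℝ) 1 := by
  have hnonneg : 0 ≤ ∫ x in (w - σ)..(w + σ), g x :=
    intervalIntegral.integral_nonneg (by linarith) fun x _ => (hg x).1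
  have hle : ‖∫ x in (w - σ)..(w + σ), g x‖ ≤ 1 * |w + σ - (w - σ)| :=
    intervalIntegral.norm_integral_le_of_norm_le_const fun x _ => by
      rw [Real.norm_of_nonneg (hg x).1]; exact (hg x).2
  rw [Real.norm_of_nonneg hnonneg, abs_of_nonneg (by linarith)] at hle
  unfold unifConv
  refine ⟨by positivity, ?_⟩
  rw [one_div_mul_eq_div, div_le_one (by positivity)]
  linarith

/-- The uniform-noise convolution of a locally integrable function is measurable. -/
theorem measurable_unifConv {σ : ℝ} {g : ℝ → ℝ}
    (hg : ∀ a b, IntervalIntegrable g volume a b) : Measurable (unifConv σ g) := by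
  have hF : Continuous fun b => ∫ x in (0 : ℝ)..b, g x :=
    intervalIntegral.continuous_primitive hg 0
  have heq : unifConv σ g = fun w =>
      (1 / (2 * σ)) * ((∫ x in (0 : ℝ)..(w + σ), g x) - ∫ x in (0 : ℝ)..(w - σ), g x) := by
    funext w
    rw [intervalIntegral.integral_interval_sub_left (hg _ _) (hg _ _)]
    rfl
  rw [heq]
  have h1 : Continuous fun w => ∫ x in (0 : ℝ)..(w + σ), g x :=
    hF.comp (continuous_id.add continuous_const)
  have h2 : Continuous fun w => ∫ x in (0 : ℝ)..(w - σ), g x :=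
    hF.comp (continuous_id.sub continuous_const)
  exact (continuous_const.mul (h1.sub h2)).measurable

theorem intervalIntegrable_stepFn {c : ℝ} (hc : c ∈ Set.Ioc (0 : ℝ) (1 / 4)) (t a b : ℝ) :
    IntervalIntegrable (stepFn c t) volume a b :=
  (intervalIntegrable_const (c := (1 : ℝ))).mono_fun
    (measurable_stepFn c t).aestronglyMeasurable <| .of_forall fun x => by
      beta_reduce
      rw [Real.norm_of_nonneg (stepFn_mem_Icc hc t x).1, norm_one]
      exact (stepFn_mem_Icc hc t x).2

/-- Smoothed step functions with thresholds `s ≤ t` agree away from `[s - σ, t + σ]`. -/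
theorem unifConv_stepFn_congr {c σ s t w : ℝ} (hσ : 0 < σ) (hst : s ≤ t)
    (hw : w ∉ Set.Icc (s - σ) (t + σ)) :
    unifConv σ (stepFn c s) w = unifConv σ (stepFn c t) w := by
  unfold unifConv
  congr 1
  refine intervalIntegral.integral_congr fun x hx => ?_
  rw [Set.uIcc_of_le (by linarith)] at hx
  obtain ⟨hx1, hx2⟩ := hx
  rcases lt_or_ge w (s - σ) with h | h
  · simp only [stepFn, if_pos (show x < s by linarith), if_pos (show x < t by linarith)]
  · have h' : t + σ < w := not_le.1 fun h'' => hw ⟨h, h''⟩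
    simp only [stepFn, if_neg (show ¬ x < s by linarith), if_neg (show ¬ x < t by linarith)]

theorem bern_map_mk_apply (p w : ℝ) {s : Set (ℝ × Bool)} (hs : MeasurableSet s) :
    (bern p).map (Prod.mk w) s = ENNReal.ofReal p * s.indicator 1 (w, true) +
      ENNReal.ofReal (1 - p) * s.indicator 1 (w, false) := by
  rw [bern, Measure.map_add _ _ measurable_prodMk_left, Measure.map_smul, Measure.map_smul,
    Measure.map_dirac' measurable_prodMk_left, Measure.map_dirac' measurable_prodMk_left]
  simp [Measure.dirac_apply' _ hs]

theorem measurable_bern_map_mk {F : ℝ → ℝ} (hF : Measurable F) :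
    Measurable fun w => (bern (F w)).map (Prod.mk w) := by
  refine Measure.measurable_of_measurable_coe _ fun s hs => ?_
  simp only [bern_map_mk_apply _ _ hs]
  have hind (b : Bool) : Measurable fun w : ℝ => s.indicator (1 : ℝ × Bool → ℝ≥0∞) (w, b) :=
    (measurable_one.indicator hs).comp measurable_prodMk_right
  exact (hF.ennreal_ofReal.mul (hind true)).add
    ((measurable_const.sub hF).ennreal_ofReal.mul (hind false))

theorem sampleLaw_apply {F : ℝ → ℝ} (hF : Measurable F) {s : Set (ℝ × Bool)}
    (hs : MeasurableSet s) :
    sampleLaw F s = ∫⁻ w, (ENNReal.ofReal (F w) * s.indicator 1 (w, true) +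
      ENNReal.ofReal (1 - F w) * s.indicator 1 (w, false))
        ∂((2 : ℝ≥0∞)⁻¹ • (volume.restrict (Set.Icc (-1 : ℝ) 1))) := by
  rw [sampleLaw, Measure.bind_apply hs (measurable_bern_map_mk hF).aemeasurable]
  simp only [bern_map_mk_apply _ _ hs]

/-- The first marginal of `sampleLaw F` is uniform on `[-1, 1]`. -/
theorem sampleLaw_preimage_fst {F : ℝ → ℝ} (hF : Measurable F)
    (hF01 : ∀ w, F w ∈ Set.Icc (0 : ℝ) 1) {A : Set ℝ} (hA : MeasurableSet A) :
    sampleLaw F (Prod.fst ⁻¹' A) = 2⁻¹ * volume (A ∩ Set.Icc (-1 : ℝ) 1) := by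
  rw [sampleLaw_apply hF (measurable_fst hA)]
  have hsum (w : ℝ) : ENNReal.ofReal (F w) * (Prod.fst ⁻¹' A).indicator 1 (w, true) +
      ENNReal.ofReal (1 - F w) * (Prod.fst ⁻¹' A).indicator 1 (w, false) =
        A.indicator (1 : ℝ → ℝ≥0∞) w := by
    by_cases hw : w ∈ A
    · simp [hw, ← ENNReal.ofReal_add (hF01 w).1 (sub_nonneg.2 (hF01 w).2)]
    · simp [hw]
  simp only [hsum]
  rw [lintegral_indicator_one hA, Measure.smul_apply, Measure.restrict_apply hA, smul_eq_mul]

theorem isProbabilityMeasure_sampleLaw {F : ℝ → ℝ} (hF : Measurable F)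
    (hF01 : ∀ w, F w ∈ Set.Icc (0 : ℝ) 1) : IsProbabilityMeasure (sampleLaw F) := by
  refine ⟨?_⟩
  rw [← Set.preimage_univ (f := Prod.fst), sampleLaw_preimage_fst hF hF01 .univ, Set.univ_inter,
    Real.volume_Icc, show (1 : ℝ) - -1 = 2 by norm_num, ENNReal.ofReal_ofNat]
  exact ENNReal.inv_mul_cancel (by simp) (by simp)

/-- If `F` and `G` agree off `A`, so do the corresponding sample laws. -/
theorem sampleLaw_restrict_congr {F G : ℝ → ℝ} (hF : Measurable F) (hG : Measurable G)
    {A : Set ℝ} (hA : MeasurableSet A) (hFG : ∀ w ∉ A, F w = G w) :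
    (sampleLaw F).restrict (Prod.fst ⁻¹' Aᶜ) = (sampleLaw G).restrict (Prod.fst ⁻¹' Aᶜ) := by
  ext s hs
  have hB : MeasurableSet (Prod.fst ⁻¹' Aᶜ : Set (ℝ × Bool)) := measurable_fst hA.compl
  rw [Measure.restrict_apply hs, Measure.restrict_apply hs, sampleLaw_apply hF (hs.inter hB),
    sampleLaw_apply hG (hs.inter hB)]
  refine lintegral_congr fun w => ?_
  by_cases hw : w ∈ A
  · simp [hw]
  · rw [hFG w hw]

/-- Two-point method: if two measures agree on an event `B`, then no estimator can have small
error under both of them. -/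
theorem mul_measure_le_lintegral_add_lintegral {Ω : Type*} [MeasurableSpace Ω] {P Q : Measure Ω}
    {B : Set Ω} (hPQ : P.restrict B = Q.restrict B) {f : Ω → ℝ} (hf : Measurable f) (s t : ℝ) :
    ENNReal.ofReal |s - t| * P B ≤
      ∫⁻ x, ENNReal.ofReal |f x - s| ∂P + ∫⁻ x, ENNReal.ofReal |f x - t| ∂Q := by
  calc ENNReal.ofReal |s - t| * P B
      = ∫⁻ _ in B, ENNReal.ofReal |s - t| ∂P := (setLIntegral_const _ _).symm
    _ ≤ ∫⁻ x in B, (ENNReal.ofReal |f x - s| + ENNReal.ofReal |f x - t|) ∂P := by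
        refine lintegral_mono fun x => ?_
        rw [← ENNReal.ofReal_add (abs_nonneg _) (abs_nonneg _)]
        refine ENNReal.ofReal_le_ofReal ?_
        rw [abs_sub_comm (f x) s]
        exact abs_sub_le s (f x) t
    _ = ∫⁻ x in B, ENNReal.ofReal |f x - s| ∂P + ∫⁻ x in B, ENNReal.ofReal |f x - t| ∂Q := by
        rw [lintegral_add_left (by fun_prop), ← hPQ]
    _ ≤ _ := add_le_add (setLIntegral_le_lintegral _ _) (setLIntegral_le_lintegral _ _)

/-- Passive minimax lower bound, `k = 1`, small noise: for `0 < σ ≤ κ₀/n`, every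
estimator based on `n` i.i.d. passive samples has worst-case point error at least
`κ₁/n` over thresholds `t ∈ [-1/2, 1/2]`. -/
theorem passive_lower_bound_k_one_small_noise (c : ℝ) (hc : c ∈ Set.Ioc (0 : ℝ) (1 / 4)) :
    ∃ κ₀ κ₁ : ℝ, 0 < κ₀ ∧ 0 < κ₁ ∧
      ∀ n : ℕ, 1 ≤ n → ∀ σ : ℝ, 0 < σ → σ ≤ κ₀ / n →
        ∀ that : (Fin n → ℝ × Bool) → ℝ, Measurable that →
          ENNReal.ofReal (κ₁ / n) ≤
            ⨆ t ∈ Set.Icc (-(1 : ℝ) / 2) (1 / 2),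
              ∫⁻ x, ENNReal.ofReal |that x - t|
                ∂(Measure.pi fun _ : Fin n => sampleLaw (unifConv σ (stepFn c t))) := by
  refine ⟨1 / 4, 1 / 8, by norm_num, by norm_num, fun n hn σ hσ hσn that hthat => ?_⟩
  have hn0 : (0 : ℝ) < n := by exact_mod_cast hn
  have hn1 : (1 : ℝ) ≤ n := by exact_mod_cast hn
  set δ : ℝ := 1 / 2 / n with hδ
  have hδ0 : 0 < δ := by positivity
  have hδ1 : δ ≤ 1 / 2 := div_le_self (by norm_num) hn1
  have hF (t : ℝ) : Measurable (unifConv σ (stepFn c t)) :=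
    measurable_unifConv (intervalIntegrable_stepFn hc t)
  have hF01 (t w : ℝ) : unifConv σ (stepFn c t) w ∈ Set.Icc (0 : ℝ) 1 :=
    unifConv_mem_Icc hσ (stepFn_mem_Icc hc t) w
  have hprob (t : ℝ) : IsProbabilityMeasure (sampleLaw (unifConv σ (stepFn c t))) :=
    isProbabilityMeasure_sampleLaw (hF t) (hF01 t)
  set A : Set ℝ := Set.Icc (0 - σ) (δ + σ) with hAdef
  have hA : MeasurableSet A := measurableSet_Icc
  set B : Set (ℝ × Bool) := Prod.fst ⁻¹' Aᶜ with hBdef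
  have hB : MeasurableSet B := measurable_fst hA.compl
  set P : ℝ → Measure (Fin n → ℝ × Bool) := fun t =>
    Measure.pi fun _ : Fin n => sampleLaw (unifConv σ (stepFn c t)) with hP
  have hagree : (P 0).restrict (Set.univ.pi fun _ => B) =
      (P δ).restrict (Set.univ.pi fun _ => B) := by
    simp only [hP, Measure.restrict_pi_pi]
    rw [hBdef, sampleLaw_restrict_congr (hF 0) (hF δ) hA
      fun w hw => unifConv_stepFn_congr hσ hδ0.le hw]
  have hsample : ENNReal.ofReal (1 - 1 / 2 / n) ≤ sampleLaw (unifConv σ (stepFn c 0)) B := by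
    rw [hBdef, Set.preimage_compl, prob_compl_eq_one_sub (measurable_fst hA),
      ENNReal.ofReal_sub _ (by positivity), ENNReal.ofReal_one]
    refine tsub_le_tsub_left ?_ _
    rw [sampleLaw_preimage_fst (hF 0) (hF01 0) hA]
    calc (2 : ℝ≥0∞)⁻¹ * volume (A ∩ Set.Icc (-1 : ℝ) 1)
        ≤ 2⁻¹ * volume A := by gcongr; exact Set.inter_subset_left
      _ = ENNReal.ofReal (2⁻¹ * (δ + σ - (0 - σ))) := by
          rw [ENNReal.ofReal_mul (by norm_num), ENNReal.ofReal_inv_of_pos (by norm_num),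
            ENNReal.ofReal_ofNat, hAdef, Real.volume_Icc]
      _ ≤ ENNReal.ofReal (1 / 2 / n) := by
          refine ENNReal.ofReal_le_ofReal ?_
          have : (1 : ℝ) / 4 / n = δ / 2 := by rw [hδ]; ring
          linarith
  have hmass : ENNReal.ofReal (1 / 2) ≤ P 0 (Set.univ.pi fun _ => B) := by
    rw [hP, Measure.pi_pi, Finset.prod_const, Finset.card_univ, Fintype.card_fin]
    refine le_trans ?_ (pow_le_pow_left' hsample n)
    rw [← ENNReal.ofReal_pow (by linarith)]
    refine ENNReal.ofReal_le_ofReal ?_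
    have hbern := one_add_mul_le_pow (a := -δ) (by linarith) n
    have : (n : ℝ) * -δ = -(1 / 2) := by rw [hδ]; field_simp
    rw [this] at hbern
    rw [sub_eq_add_neg]
    linarith
  have htwo := mul_measure_le_lintegral_add_lintegral hagree hthat 0 δ
  set S : ℝ≥0∞ := ⨆ t ∈ Set.Icc (-(1 : ℝ) / 2) (1 / 2), ∫⁻ x, ENNReal.ofReal |that x - t| ∂(P t)
  have hS (t : ℝ) (ht : t ∈ Set.Icc (-(1 : ℝ) / 2) (1 / 2)) :
      ∫⁻ x, ENNReal.ofReal |that x - t| ∂(P t) ≤ S :=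
    le_iSup₂ (f := fun t (_ : t ∈ Set.Icc (-(1 : ℝ) / 2) (1 / 2)) =>
      ∫⁻ x, ENNReal.ofReal |that x - t| ∂(P t)) t ht
  have hle : ENNReal.ofReal (1 / 8 / n) * 2 ≤ S * 2 := by
    calc ENNReal.ofReal (1 / 8 / n) * 2
        = ENNReal.ofReal |0 - δ| * ENNReal.ofReal (1 / 2) := by
          rw [← ENNReal.ofReal_ofNat, ← ENNReal.ofReal_mul (by positivity),
            ← ENNReal.ofReal_mul (abs_nonneg _), zero_sub, abs_neg, abs_of_pos hδ0, hδ]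
          congr 1
          ring
      _ ≤ ENNReal.ofReal |0 - δ| * P 0 (Set.univ.pi fun _ => B) := by gcongr
      _ ≤ _ := htwo
      _ ≤ S + S := add_le_add (hS 0 (by constructor <;> norm_num)) (hS δ ⟨by linarith, hδ1⟩)
      _ = S * 2 := (mul_two S).symm
  exact (ENNReal.mul_le_mul_iff_left (by simp) (by simp)).1 hle
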